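/- Let n ≥ 1 be an integer. For every Schwartz function φ : EuclideanSpace ℝ (Fin n) → ℝ, ∫ G_n(x) · (φ(x) − Δφ(x)) dx = φ(0), where the integral is with respect to Lebesgue measure. -/

import Mathlib

open MeasureTheory Real SchwartzMap

/-- The Bessel potential `G_n` on `ℝⁿ`. -/
noncomputable def besselG (n : ℕ) (x : EuclideanSpace ℝ (Fin n)) : ℝ :=
  ∫ t in Set.Ioi (0 : ℝ), (4 * Real.pi * t) ^ (-(n : ℝ) / 2) *
    Real.exp (-(‖x‖ ^ 2) / (4 * t) - t)

/-- Pointwise Laplacian of `f : ℝⁿ → ℝ`. -/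
noncomputable def ptLaplacian {n : ℕ} (f : EuclideanSpace ℝ (Fin n) → ℝ)
    (x : EuclideanSpace ℝ (Fin n)) : ℝ :=
  ∑ i : Fin n, iteratedDeriv 2 (fun t : ℝ => f (x + t • EuclideanSpace.single i (1 : ℝ))) 0

open scoped FourierTransform Laplacian LineDeriv

/-- The heat kernel `(4πt)^(-n/2) exp(-‖x‖²/(4t))` on `ℝⁿ`. -/
noncomputable def heatKernel (n : ℕ) (t : ℝ) (x : EuclideanSpace ℝ (Fin n)) : ℝ :=
  (4 * π * t) ^ (-(n : ℝ) / 2) * rexp (-(‖x‖ ^ 2) / (4 * t))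

variable {n : ℕ}

lemma heatKernel_nonneg {t : ℝ} (ht : 0 < t) (x : EuclideanSpace ℝ (Fin n)) :
    0 ≤ heatKernel n t x := by
  unfold heatKernel; positivity

lemma measurable_heatKernel :
    Measurable (fun p : EuclideanSpace ℝ (Fin n) × ℝ => heatKernel n p.2 p.1) := by
  unfold heatKernel; fun_prop

lemma besselG_eq_integral_heatKernel (x : EuclideanSpace ℝ (Fin n)) :
    besselG n x = ∫ t in Set.Ioi (0 : ℝ), rexp (-t) * heatKernel n t x := by
  unfold besselG heatKernel
  congr 1 with t
  rw [sub_eq_add_neg, Real.exp_add]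
  ring

lemma integrable_exp_neg_mul_sq_norm {b : ℝ} (hb : 0 < b) :
    Integrable (fun x : EuclideanSpace ℝ (Fin n) => rexp (-b * ‖x‖ ^ 2)) := by
  have h := (GaussianFourier.integrable_cexp_neg_mul_sq_norm_add (b := (b : ℂ)) (by simpa) 0
    (0 : EuclideanSpace ℝ (Fin n))).norm
  refine h.congr (.of_forall fun x => ?_)
  simp [Complex.norm_exp, ← Complex.ofReal_pow]

lemma integrable_heatKernel {t : ℝ} (ht : 0 < t) : Integrable (heatKernel n t) := by
  have h := (integrable_exp_neg_mul_sq_norm (n := n) (b := (4 * t)⁻¹) (by positivity)).const_mul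
    ((4 * π * t) ^ (-(n : ℝ) / 2))
  refine h.congr (.of_forall fun x => ?_)
  simp only [heatKernel]
  congr 2
  ring

lemma integral_heatKernel {t : ℝ} (ht : 0 < t) : ∫ x, heatKernel n t x = 1 := by
  have h := GaussianFourier.integral_rexp_neg_mul_sq_norm (V := EuclideanSpace ℝ (Fin n))
    (b := (4 * t)⁻¹) (by positivity)
  have h' : ∀ x : EuclideanSpace ℝ (Fin n),
      heatKernel n t x = (4 * π * t) ^ (-(n : ℝ) / 2) * rexp (-(4 * t)⁻¹ * ‖x‖ ^ 2) := by
    intro x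
    simp only [heatKernel]
    congr 2
    ring
  simp_rw [h', integral_const_mul, h]
  have h4 : π / (4 * t)⁻¹ = 4 * π * t := by rw [div_inv_eq_mul]; ring
  rw [h4, finrank_euclideanSpace_fin, ← Real.rpow_add (by positivity)]
  ring_nf
  simp

/-- The heat kernel is the Fourier transform of `exp (-4π²t‖ξ‖²)`. -/
lemma fourier_exp_neg_mul_sq_norm_eq_heatKernel {t : ℝ} (ht : 0 < t)
    (x : EuclideanSpace ℝ (Fin n)) :
    𝓕 (fun ξ : EuclideanSpace ℝ (Fin n) => (rexp (-(4 * π ^ 2 * t) * ‖ξ‖ ^ 2) : ℂ)) x =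
      heatKernel n t x := by
  have hb : 0 < 4 * π ^ 2 * t := by positivity
  have h := fourier_gaussian_innerProductSpace (V := EuclideanSpace ℝ (Fin n))
    (b := ((4 * π ^ 2 * t : ℝ) : ℂ)) (by rwa [Complex.ofReal_re]) x
  have h1 : (fun ξ : EuclideanSpace ℝ (Fin n) => (rexp (-(4 * π ^ 2 * t) * ‖ξ‖ ^ 2) : ℂ)) =
      fun ξ => Complex.exp (-((4 * π ^ 2 * t : ℝ) : ℂ) * ‖ξ‖ ^ 2) := by
    ext ξ; push_cast; rfl
  rw [h1, h, heatKernel, finrank_euclideanSpace_fin, ← Complex.ofReal_div,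
    show ((n : ℂ) / 2) = ((n / 2 : ℝ) : ℂ) by push_cast; rfl,
    ← Complex.ofReal_cpow (by positivity), Complex.ofReal_mul (_ ^ _)]
  congr 1
  · rw [show π / (4 * π ^ 2 * t) = (4 * π * t)⁻¹ by field_simp, Real.inv_rpow (by positivity),
      ← Real.rpow_neg (by positivity), neg_div]
  · push_cast
    congr 1
    have : (π : ℂ) ≠ 0 := by exact_mod_cast pi_ne_zero
    have : (t : ℂ) ≠ 0 := by exact_mod_cast ht.ne'
    field_simp

/-- The Fourier transform of integrable functions is self-adjoint. -/
lemma integral_fourier_mul_eq_flip {f g : EuclideanSpace ℝ (Fin n) → ℂ}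
    (hf : Integrable f) (hg : Integrable g) : ∫ ξ, 𝓕 f ξ * g ξ = ∫ x, f x * 𝓕 g x := by
  simpa using! VectorFourier.integral_bilin_fourierIntegral_eq_flip (.mul ℂ ℂ)
    (L := innerₗ (EuclideanSpace ℝ (Fin n))) continuous_fourierChar continuous_inner hf hg

lemma integral_heatKernel_mul {t : ℝ} (ht : 0 < t) (f : 𝓢(EuclideanSpace ℝ (Fin n), ℂ)) :
    ∫ x, (heatKernel n t x : ℂ) * f x =
      ∫ ξ, (rexp (-(4 * π ^ 2 * t) * ‖ξ‖ ^ 2) : ℂ) * 𝓕 f ξ := by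
  simp_rw [← fourier_exp_neg_mul_sq_norm_eq_heatKernel ht]
  exact integral_fourier_mul_eq_flip
    (integrable_exp_neg_mul_sq_norm (by positivity)).ofReal f.integrable

lemma integral_besselG_mul_eq_integral_heatKernel (f : 𝓢(EuclideanSpace ℝ (Fin n), ℂ)) :
    ∫ x, (besselG n x : ℂ) * f x =
      ∫ t in Set.Ioi (0 : ℝ), (rexp (-t) : ℂ) * ∫ x, (heatKernel n t x : ℂ) * f x := by
  have hint : Integrable (fun p : EuclideanSpace ℝ (Fin n) × ℝ =>
      rexp (-p.2) * heatKernel n p.2 p.1)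
      (volume.prod (volume.restrict (Set.Ioi 0))) := by
    have hm : Measurable (fun p : EuclideanSpace ℝ (Fin n) × ℝ =>
        rexp (-p.2) * heatKernel n p.2 p.1) :=
      (by fun_prop : Measurable fun p : EuclideanSpace ℝ (Fin n) × ℝ => rexp (-p.2)).mul
        measurable_heatKernel
    rw [integrable_prod_iff' hm.aestronglyMeasurable]
    constructor
    · filter_upwards [ae_restrict_mem measurableSet_Ioi] with t ht
      exact (integrable_heatKernel ht).const_mul _
    · refine (integrableOn_exp_neg_Ioi 0).congr ?_
      filter_upwards [ae_restrict_mem measurableSet_Ioi] with t ht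
      have h : ∀ x, ‖rexp (-t) * heatKernel n t x‖ = rexp (-t) * heatKernel n t x := fun x =>
        Real.norm_of_nonneg (mul_nonneg (exp_nonneg _) (heatKernel_nonneg ht x))
      simp_rw [h, integral_const_mul, integral_heatKernel ht, mul_one]
  have hint' : Integrable (Function.uncurry fun (x : EuclideanSpace ℝ (Fin n)) (t : ℝ) =>
      ((rexp (-t) * heatKernel n t x : ℝ) : ℂ) * f x)
      (volume.prod (volume.restrict (Set.Ioi 0))) := by
    obtain ⟨C, hC⟩ := f.decay 0 0
    refine hint.ofReal.mul_bdd (c := C) (f.continuous.comp continuous_fst).aestronglyMeasurable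
      (.of_forall fun p => ?_)
    simpa using hC.2 p.1
  calc ∫ x, (besselG n x : ℂ) * f x
      = ∫ x, ∫ t in Set.Ioi (0 : ℝ), ((rexp (-t) * heatKernel n t x : ℝ) : ℂ) * f x := by
        congr 1 with x
        rw [integral_mul_const, integral_complex_ofReal, besselG_eq_integral_heatKernel]
    _ = _ := by
        rw [integral_integral_swap hint']
        simp_rw [Complex.ofReal_mul, mul_assoc, integral_const_mul]

lemma integral_besselG_mul_eq_integral_fourier (f : 𝓢(EuclideanSpace ℝ (Fin n), ℂ)) :
    ∫ x, (besselG n x : ℂ) * f x =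
      ∫ ξ, (((1 + 4 * π ^ 2 * ‖ξ‖ ^ 2)⁻¹ : ℝ) : ℂ) * 𝓕 f ξ := by
  have hint : Integrable (Function.uncurry fun (t : ℝ) (ξ : EuclideanSpace ℝ (Fin n)) =>
      (rexp (-(1 + 4 * π ^ 2 * ‖ξ‖ ^ 2) * t) : ℂ) * 𝓕 f ξ)
      ((volume.restrict (Set.Ioi 0)).prod volume) := by
    have h := Integrable.mul_prod ((integrableOn_exp_neg_Ioi 0).ofReal (𝕜 := ℂ))
      ((𝓕 f).integrable (μ := volume))
    refine h.mono ?_ ?_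
    · refine Continuous.aestronglyMeasurable ?_
      simp only [Function.uncurry_def]
      have := (𝓕 f).continuous
      fun_prop
    · have hae : ∀ᵐ p : ℝ × EuclideanSpace ℝ (Fin n)
          ∂((volume.restrict (Set.Ioi 0)).prod volume), 0 < p.1 :=
        Measure.quasiMeasurePreserving_fst.ae (ae_restrict_mem measurableSet_Ioi)
      filter_upwards [hae] with p hp
      simp only [Function.uncurry, norm_mul, Complex.coe_algebraMap, Complex.norm_real,
        Real.norm_eq_abs, abs_exp]
      gcongr
      have : 0 ≤ 4 * π ^ 2 * ‖p.2‖ ^ 2 * p.1 := by positivity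
      linarith
  calc ∫ x, (besselG n x : ℂ) * f x
      = ∫ t in Set.Ioi (0 : ℝ), ∫ ξ : EuclideanSpace ℝ (Fin n),
          (rexp (-(1 + 4 * π ^ 2 * ‖ξ‖ ^ 2) * t) : ℂ) * 𝓕 f ξ := by
        rw [integral_besselG_mul_eq_integral_heatKernel]
        refine setIntegral_congr_fun measurableSet_Ioi fun t ht => ?_
        rw [integral_heatKernel_mul ht, ← integral_const_mul]
        congr 1 with ξ
        rw [← mul_assoc, ← Complex.ofReal_mul, ← Real.exp_add]
        congr 4
        ring
    _ = _ := by
        rw [integral_integral_swap hint]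
        congr 1 with ξ
        have hpos : 0 < 1 + 4 * π ^ 2 * ‖ξ‖ ^ 2 := by positivity
        rw [integral_mul_const, integral_complex_ofReal,
          integral_exp_mul_Ioi (neg_lt_zero.mpr hpos), mul_zero, exp_zero,
          neg_div_neg_eq, one_div]

lemma fourier_laplacian_apply (f : 𝓢(EuclideanSpace ℝ (Fin n), ℂ))
    (ξ : EuclideanSpace ℝ (Fin n)) :
    𝓕 (Δ f) ξ = -((4 * π ^ 2 * ‖ξ‖ ^ 2 : ℝ) : ℂ) * 𝓕 f ξ := by
  have hg : Function.HasTemperateGrowth (fun x : EuclideanSpace ℝ (Fin n) => ‖x‖ ^ 2) := by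
    fun_prop
  have h : 𝓕 (Δ f) = -(2 * π) ^ 2 • smulLeftCLM ℂ (fun x => ‖x‖ ^ 2) (𝓕 f) := by
    rw [laplacian_eq_fourierMultiplierCLM, fourierMultiplierCLM_apply,
      ← FourierTransform.fourierInv_smul, FourierTransform.fourier_fourierInv_eq]
  rw [h, smul_apply, smulLeftCLM_apply_apply hg]
  simp only [Complex.real_smul]
  push_cast
  ring

lemma integral_besselG_mul_sub_laplacian (f : 𝓢(EuclideanSpace ℝ (Fin n), ℂ)) :
    ∫ x, (besselG n x : ℂ) * (f - Δ f) x = f 0 := by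
  rw [integral_besselG_mul_eq_integral_fourier]
  have h : ∀ ξ : EuclideanSpace ℝ (Fin n),
      (((1 + 4 * π ^ 2 * ‖ξ‖ ^ 2)⁻¹ : ℝ) : ℂ) * 𝓕 (f - Δ f) ξ = 𝓕 f ξ := by
    intro ξ
    have hpos : 0 < 1 + 4 * π ^ 2 * ‖ξ‖ ^ 2 := by positivity
    rw [show 𝓕 (f - Δ f) = 𝓕 f - 𝓕 (Δ f) from map_sub (fourierTransformCLM ℂ) _ _, sub_apply,
      fourier_laplacian_apply]
    have hne : ((1 + 4 * π ^ 2 * ‖ξ‖ ^ 2 : ℝ) : ℂ) ≠ 0 := by exact_mod_cast hpos.ne'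
    rw [Complex.ofReal_inv, inv_mul_eq_iff_eq_mul₀ hne]
    push_cast
    ring
  simp_rw [h]
  have h0 : (𝓕⁻ (𝓕 f)) 0 = f 0 := by rw [FourierTransform.fourierInv_fourier_eq]
  rw [← h0, fourierInv_coe, Real.fourierInv_eq]
  simp

lemma ptLaplacian_eq_laplacian (φ : 𝓢(EuclideanSpace ℝ (Fin n), ℝ))
    (x : EuclideanSpace ℝ (Fin n)) : ptLaplacian φ x = Δ φ x := by
  rw [laplacian_eq_sum (EuclideanSpace.basisFun (Fin n) ℝ), ptLaplacian, sum_apply]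
  refine Finset.sum_congr rfl fun i _ => ?_
  have hd : ∀ (g : 𝓢(EuclideanSpace ℝ (Fin n), ℝ)) (v : EuclideanSpace ℝ (Fin n)),
      deriv (fun t : ℝ => g (x + t • v)) = fun t => ∂_{v} g (x + t • v) := by
    intro g v
    ext t
    have hl : HasDerivAt (fun t : ℝ => x + t • v) v t := by
      simpa using ((hasDerivAt_id t).smul_const v).const_add x
    exact ((g.hasFDerivAt _).comp_hasDerivAt t hl).deriv
  rw [iteratedDeriv_succ', iteratedDeriv_one, hd, hd]
  simp

/-- Identity (4.100)/(4.101) of Lemma 4.1: `G_n − ΔG_n = δ₀` as tempered distributions,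
i.e. `∫ G_n (φ − Δφ) = φ(0)` for every Schwartz function `φ`. -/
theorem stmt10 (n : ℕ) (hn : 1 ≤ n)
    (φ : SchwartzMap (EuclideanSpace ℝ (Fin n)) ℝ) :
    ∫ x, besselG n x * (φ x - ptLaplacian (⇑φ) x) = φ 0 := by
  let f : 𝓢(EuclideanSpace ℝ (Fin n), ℂ) := φ.postcompCLM Complex.ofRealCLM
  have hf : ∀ x, f x = φ x := fun x => rfl
  have hΔ : ∀ x, Δ f x = ptLaplacian φ x := by
    intro x
    rw [ptLaplacian_eq_laplacian, laplacian_apply, laplacian_apply]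
    exact ((φ.smooth 2).contDiffAt).laplacian_CLM_comp_left (l := Complex.ofRealCLM)
  have h := integral_besselG_mul_sub_laplacian f
  simp_rw [sub_apply, hf, hΔ, ← Complex.ofReal_sub, ← Complex.ofReal_mul] at h
  rw [integral_complex_ofReal] at h
  exact_mod_cast h
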